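/- arXiv:2410.07457 — 2 statements merged into one kernel-verified Lean document; each statement's English description precedes it below -/
import Mathlib

section
/- Let N, M, K, H be positive integers, let U ∈ ℝ^{N×M} have nonnegative entries with Ū = max_{i,j} U_{ij}, let ε ≥ 0 and ν > 0. Let 𝒴 : Δ_N → ℝ^{M×K} be a measurable map each of whose columns lies in Δ_M. Let g^1, …, g^H ∈ {e_1,…,e_K} (standard basis of ℝ^K) and set G^t = Σ_{τ=1}^t g^τ with G^0 = 0. Let σ = (σ_1,…,σ_K) have i.i.d. coordinates uniform on [0, 2/ν]. Suppose W : ℝ^K_{≥0} → Δ_N is a measurable map satisfying ⟨𝒴(W(G))ᵀ Uᵀ W(G), G⟩ ≥ sup_{x∈Δ_N} ⟨𝒴(x)ᵀ Uᵀ x, G⟩ − ε for every G ∈ ℝ^K_{≥0}, and set x^t = W(G^{t−1} + σ) for t = 1, …, H. Then E[ sup_{x∈Δ_N} ⟨𝒴(x)ᵀ Uᵀ x, G^H⟩ − Σ_{t=1}^H ⟨𝒴(x^t)ᵀ Uᵀ x^t, g^t⟩ ] ≤ ν H Ū + Ū K/ν + ε(H+1), where the expectation is over σ. -/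
open MeasureTheory

/-- The law of a random vector in `ℝ^K` whose coordinates are i.i.d. uniform on `[0, 2/ν]`:
the product of `K` copies of the normalized Lebesgue measure on `[0, 2/ν]`. -/
noncomputable def uniformCube (K : ℕ) (ν : ℝ) : Measure (Fin K → ℝ) :=
  Measure.pi fun _ =>
    (ENNReal.ofReal (2 / ν))⁻¹ • (volume.restrict (Set.Icc (0 : ℝ) (2 / ν)))

/-- The leader's payoff `⟨𝒴(x)ᵀ Uᵀ x, g⟩ = ∑_k g_k · xᵀ U y^k(x)`, where `Y x k` is the
`k`-th column of the follower-response matrix `𝒴(x)`. -/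
noncomputable def payoff {N M K : ℕ} (U : Matrix (Fin N) (Fin M) ℝ)
    (Y : (Fin N → ℝ) → Fin K → Fin M → ℝ) (x : Fin N → ℝ) (g : Fin K → ℝ) : ℝ :=
  ∑ k, g k * ∑ i, x i * ∑ j, U i j * Y x k j

lemma cube_eq (K : ℕ) (ν : ℝ) : uniformCube K ν = ((ENNReal.ofReal (2 / ν))⁻¹ ^ K) •
    (volume : Measure (Fin K → ℝ)).restrict (Set.pi Set.univ fun _ => Set.Icc (0:ℝ) (2/ν)) := by
  by_cases hL : ENNReal.ofReal (2 / ν) = 0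
  · unfold uniformCube
    rw [volume_pi, Measure.restrict_pi_pi]
    have h0 : (volume : Measure ℝ).restrict (Set.Icc 0 (2/ν)) = 0 := by
      rw [Measure.restrict_eq_zero, Real.volume_Icc, sub_zero, hL]
    simp only [h0, smul_zero, hL]
    rcases K.eq_zero_or_pos with rfl | hK
    · simp
    · have : Nonempty (Fin K) := ⟨⟨0, hK⟩⟩
      have : Measure.pi (fun _ : Fin K => (0 : Measure ℝ)) = 0 := by
        rw [← Measure.measure_univ_eq_zero, Measure.pi_univ]
        simp [hK.ne']
      rw [this, smul_zero]
  · unfold uniformCube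
    have hfin : (ENNReal.ofReal (2 / ν))⁻¹ ≠ ⊤ := by simpa using hL
    have : IsFiniteMeasure ((ENNReal.ofReal (2 / ν))⁻¹ • (volume.restrict (Set.Icc (0 : ℝ) (2 / ν)))) :=
      Measure.smul_finite _ hfin
    refine Measure.pi_eq fun s hs => ?_
    rw [volume_pi, Measure.restrict_pi_pi, Measure.smul_apply, Measure.pi_pi]
    simp [Finset.prod_mul_distrib]

lemma cube_prob (K : ℕ) {ν : ℝ} (hν : 0 < ν) : IsProbabilityMeasure
    ((ENNReal.ofReal (2 / ν))⁻¹ • (volume.restrict (Set.Icc (0 : ℝ) (2 / ν)))) := by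
  constructor
  have : 0 < 2 / ν := by positivity
  simp only [Measure.smul_apply, Measure.restrict_apply MeasurableSet.univ, Set.univ_inter,
    Real.volume_Icc, sub_zero, smul_eq_mul]
  exact ENNReal.inv_mul_cancel (by simpa using this) (by simp)

lemma cube_nonneg (K : ℕ) (ν : ℝ) : ∀ᵐ σ ∂(uniformCube K ν), ∀ k, 0 ≤ σ k := by
  rw [cube_eq]
  refine Measure.ae_smul_measure ?_ _
  rw [ae_restrict_iff' (MeasurableSet.univ_pi fun _ => measurableSet_Icc)]
  filter_upwards with σ h k
  exact (h k trivial).1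

lemma cube_mean (K : ℕ) {ν : ℝ} (hν : 0 < ν) (k : Fin K) :
    Integrable (fun σ => σ k) (uniformCube K ν) ∧ ∫ σ, σ k ∂(uniformCube K ν) = 1 / ν := by
  have := cube_prob K hν
  have hL : 0 < 2 / ν := by positivity
  have mp := measurePreserving_eval (fun _ : Fin K =>
    ((ENNReal.ofReal (2 / ν))⁻¹ • ((volume : Measure ℝ).restrict (Set.Icc (0 : ℝ) (2 / ν))))) k
  have hi : Integrable (fun x : ℝ => x)
    ((ENNReal.ofReal (2 / ν))⁻¹ • ((volume : Measure ℝ).restrict (Set.Icc (0 : ℝ) (2 / ν)))) := by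
    refine Integrable.smul_measure ?_ (by simpa using hL)
    exact (continuous_id.continuousOn).integrableOn_Icc
  constructor
  · exact mp.integrable_comp_of_integrable hi
  · have := integral_map (μ := uniformCube K ν) mp.measurable.aemeasurable (f := fun x : ℝ => x)
      (by fun_prop)
    simp only [Function.eval] at this
    rw [← this]
    unfold uniformCube
    erw [mp.map_eq]
    rw [integral_smul_measure, integral_Icc_eq_integral_Ioc, ← intervalIntegral.integral_of_le hL.le,
      integral_id]
    rw [ENNReal.toReal_inv, ENNReal.toReal_ofReal hL.le]
    simp only [smul_eq_mul]
    field_simp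
    norm_num

lemma cube_shift (K : ℕ) {ν : ℝ} (hν : 0 < ν) (k : Fin K) (f : (Fin K → ℝ) → ℝ)
    (hf : Measurable f) (B : ℝ) (hB : 0 ≤ B) (h0 : ∀ σ, (∀ i, 0 ≤ σ i) → 0 ≤ f σ)
    (h1 : ∀ σ, (∀ i, 0 ≤ σ i) → f σ ≤ B) :
    ∫ σ, f (σ + Pi.single k 1) ∂(uniformCube K ν) ≤ ∫ σ, f σ ∂(uniformCube K ν) + B * (ν / 2) := by
  have hL : 0 < 2 / ν := by positivity
  rw [cube_eq, integral_smul_measure, integral_smul_measure]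
  set L := 2 / ν with hLdef
  set Q : Set (Fin K → ℝ) := Set.pi Set.univ fun _ => Set.Icc (0:ℝ) L with hQ
  set e : Fin K → ℝ := Pi.single k 1 with he
  have he0 : ∀ i, 0 ≤ e i := fun i => by
    rw [he]; by_cases h : i = k
    · subst h; simp
    · simp [h]
  set R : Set (Fin K → ℝ) := Set.pi Set.univ
    (Function.update (fun _ => Set.Icc (0:ℝ) L) k (Set.Icc L (L+1))) with hR
  have mQ : MeasurableSet Q := MeasurableSet.univ_pi fun _ => measurableSet_Icc
  have mR : MeasurableSet R := MeasurableSet.univ_pi fun i => by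
    by_cases h : i = k
    · subst h; simp
    · simp [h]
  have vR : volume R = ENNReal.ofReal L ^ (K - 1) := by
    rw [hR, volume_pi_pi, ← Finset.mul_prod_erase _ _ (Finset.mem_univ k)]
    rw [Finset.prod_congr rfl (g := fun _ => ENNReal.ofReal L)]
    · simp
    · intro i hi
      rw [Function.update_of_ne (Finset.ne_of_mem_erase hi)]; simp
  have vQ : volume Q = ENNReal.ofReal L ^ K := by
    rw [hQ, volume_pi_pi]; simp
  have key : ∫ σ in Q, f (σ + e) ≤ (∫ σ in Q, f σ) + B * L ^ (K - 1) := by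
    set Q' : Set (Fin K → ℝ) := (fun x => x - e) ⁻¹' Q with hQ'
    have mQ' : MeasurableSet Q' := mQ.preimage (by fun_prop)
    have vQ' : volume Q' = volume Q := by
      simp only [hQ', sub_eq_add_neg]
      exact measure_preimage_add_right _ _ _
    have nQ : ∀ x ∈ Q, ∀ i, 0 ≤ x i := fun x hx i => (hx i trivial).1
    have nQ' : ∀ x ∈ Q', ∀ i, 0 ≤ x i := fun x hx i => by
      have := (hx i trivial).1
      have h2 := he0 i
      simp only [Pi.sub_apply] at this
      linarith
    have hint : ∀ S : Set (Fin K → ℝ), MeasurableSet S → volume S ≠ ⊤ →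
        (∀ x ∈ S, ∀ i, 0 ≤ x i) → Integrable (S.indicator f) := by
      intro S mS hS hn
      rw [integrable_indicator_iff mS]
      refine Measure.integrableOn_of_bounded hS hf.aestronglyMeasurable (M := B) ?_
      rw [ae_restrict_iff' mS]
      filter_upwards with x hx
      rw [Real.norm_eq_abs, abs_of_nonneg (h0 x (hn x hx))]
      exact h1 x (hn x hx)
    have e1 : ∫ σ in Q, f (σ + e) = ∫ σ, Q'.indicator f σ := by
      rw [← integral_add_right_eq_self (Q'.indicator f) e, ← integral_indicator mQ]
      congr 1; ext x
      have hiff : x + e ∈ Q' ↔ x ∈ Q := by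
        rw [hQ', Set.mem_preimage, add_sub_cancel_right]
      by_cases hx : x ∈ Q
      · rw [Set.indicator_of_mem hx, Set.indicator_of_mem (hiff.2 hx)]
      · rw [Set.indicator_of_notMem hx, Set.indicator_of_notMem (fun h => hx (hiff.1 h))]
    have iR : Integrable (R.indicator fun _ => B) := by
      rw [integrable_indicator_iff mR]
      exact integrableOn_const (by rw [vR]; simp)
    have iQ := hint Q mQ (by rw [vQ]; simp) nQ
    have e2 : ∫ σ, R.indicator (fun _ => B) σ = B * L ^ (K - 1) := by
      rw [integral_indicator mR, setIntegral_const, measureReal_def, vR, ENNReal.toReal_pow,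
        ENNReal.toReal_ofReal hL.le, smul_eq_mul, mul_comm]
    rw [e1, ← integral_indicator mQ, ← e2, ← integral_add iQ iR]
    refine integral_mono (hint Q' mQ' (by rw [vQ', vQ]; simp) nQ') (iQ.add iR) fun x => ?_
    simp only [Pi.add_apply]
    have r0 : 0 ≤ R.indicator (fun _ => B) x := Set.indicator_nonneg (fun _ _ => hB) x
    have q0 : 0 ≤ Q.indicator f x := Set.indicator_nonneg (fun y hy => h0 y (nQ y hy)) x
    by_cases hx' : x ∈ Q'
    · rw [Set.indicator_of_mem hx']
      by_cases hx : x ∈ Q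
      · rw [Set.indicator_of_mem hx]; linarith
      · have : x ∈ R := by
          have hoth : ∀ i, i ≠ k → x i ∈ Set.Icc 0 L := by
            intro i hi
            have := hx' i trivial
            simpa [he, hi] using this
          have hk := hx' k trivial
          simp only [Pi.sub_apply, he, Pi.single_eq_same, Set.mem_Icc] at hk
          have hxk : L ≤ x k := by
            by_contra hlt
            apply hx
            intro i _
            by_cases hi : i = k
            · subst hi; exact ⟨by linarith, by linarith⟩
            · exact hoth i hi
          intro i _
          by_cases hi : i = k
          · subst hi; simp only [Function.update_self]; exact ⟨hxk, by linarith⟩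
          · rw [Function.update_of_ne hi]; exact hoth i hi
        rw [Set.indicator_of_mem this]
        linarith [h1 x (nQ' x hx')]
    · rw [Set.indicator_of_notMem hx']; linarith
  have hc : ((ENNReal.ofReal L)⁻¹ ^ K).toReal = (L ^ K)⁻¹ := by
    rw [ENNReal.toReal_pow, ENNReal.toReal_inv, ENNReal.toReal_ofReal hL.le, inv_pow]
  rw [hc, smul_eq_mul, smul_eq_mul]
  have hp : L ^ K = L ^ (K-1) * L := by
    have := k.pos
    rw [← pow_succ]; congr 1; omega
  have hν2 : ν / 2 = L⁻¹ := by rw [hLdef]; field_simp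
  calc (L ^ K)⁻¹ * ∫ σ in Q, f (σ + e) ≤ (L ^ K)⁻¹ * ((∫ σ in Q, f σ) + B * L ^ (K - 1)) := by gcongr
    _ = _ := by
      rw [mul_add, hν2]; congr 1
      rw [hp]; field_simp

/-- **Regret bound of FTPL against memory-less followers (general perturbation rate ν).**
Leader payoff matrix `U ≥ 0` with maximal entry `Ū`; follower response map `𝒴 : Δ_N → ℝ^{M×K}`
measurable with columns in `Δ_M`; follower types `g^1, …, g^H ∈ {e_1,…,e_K}` with partial sums
`G^t`; `σ` uniform on `[0, 2/ν]^K`; `W` an `ε`-approximate maximization oracle of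
`x ↦ ⟨𝒴(x)ᵀ Uᵀ x, G⟩` over `Δ_N` for every `G ≥ 0`; decisions `x^t = W(G^{t−1} + σ)`
(0-indexed: round `t < H` uses `G t = ∑_{τ<t} g τ`).  Then the expected regret satisfies
`E[sup_{x∈Δ_N} ⟨𝒴(x)ᵀUᵀx, G^H⟩ − ∑_t ⟨𝒴(x^t)ᵀUᵀx^t, g^t⟩] ≤ νHŪ + ŪK/ν + ε(H+1)`. -/
theorem stmt7 {N M K : ℕ} (hN : 0 < N) (hM : 0 < M) (hK : 0 < K)
    (H : ℕ) (hH : 0 < H)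
    (U : Matrix (Fin N) (Fin M) ℝ) (hU : ∀ i j, 0 ≤ U i j)
    (Ubar : ℝ)
    (hUbar : Ubar = Finset.univ.sup' (Finset.univ_nonempty_iff.mpr ⟨⟨0, hN⟩⟩)
      (fun i => Finset.univ.sup' (Finset.univ_nonempty_iff.mpr ⟨⟨0, hM⟩⟩) (fun j => U i j)))
    (ε ν : ℝ) (hε : 0 ≤ ε) (hν : 0 < ν)
    (Y : (Fin N → ℝ) → Fin K → Fin M → ℝ)
    (hYmeas : ∀ k j, Measurable (fun x => Y x k j))
    (hYsimplex : ∀ x ∈ stdSimplex ℝ (Fin N), ∀ k, Y x k ∈ stdSimplex ℝ (Fin M))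
    (g : ℕ → Fin K → ℝ) (hg : ∀ t < H, ∃ k, g t = Pi.single k 1)
    (W : (Fin K → ℝ) → (Fin N → ℝ)) (hWmeas : Measurable W)
    (hWsimplex : ∀ G : Fin K → ℝ, (∀ k, 0 ≤ G k) → W G ∈ stdSimplex ℝ (Fin N))
    (hOracle : ∀ G : Fin K → ℝ, (∀ k, 0 ≤ G k) →
      sSup ((fun x => payoff U Y x G) '' stdSimplex ℝ (Fin N)) - ε ≤ payoff U Y (W G) G) :
    (∫ σ, (sSup ((fun x => payoff U Y x (∑ τ ∈ Finset.range H, g τ)) '' stdSimplex ℝ (Fin N))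
        - ∑ t ∈ Finset.range H, payoff U Y (W ((∑ τ ∈ Finset.range t, g τ) + σ)) (g t))
      ∂(uniformCube K ν)) ≤
      ν * H * Ubar + Ubar * K / ν + ε * (H + 1) := by
  have hUle : ∀ i j, U i j ≤ Ubar := by
    intro i j
    rw [hUbar]
    refine le_trans ?_ (Finset.le_sup' (fun i => Finset.univ.sup'
      (Finset.univ_nonempty_iff.mpr ⟨⟨0, hM⟩⟩) (fun j => U i j)) (Finset.mem_univ i))
    exact Finset.le_sup' (fun j => U i j) (Finset.mem_univ j)
  have hUb0 : 0 ≤ Ubar := (hU ⟨0, hN⟩ ⟨0, hM⟩).trans (hUle _ _)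
  clear hUbar
  let p : (Fin N → ℝ) → Fin K → ℝ := fun x k => ∑ i, x i * ∑ j, U i j * Y x k j
  have hpay : ∀ x G, payoff U Y x G = ∑ k, G k * p x k := fun _ _ => rfl
  have hp0 : ∀ x ∈ stdSimplex ℝ (Fin N), ∀ k, 0 ≤ p x k := fun x hx k =>
    Finset.sum_nonneg fun i _ => mul_nonneg (hx.1 i) (Finset.sum_nonneg fun j _ =>
      mul_nonneg (hU i j) ((hYsimplex x hx k).1 j))
  have hp1 : ∀ x ∈ stdSimplex ℝ (Fin N), ∀ k, p x k ≤ Ubar := fun x hx k => by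
    calc p x k ≤ ∑ i, x i * Ubar := by
          refine Finset.sum_le_sum fun i _ => mul_le_mul_of_nonneg_left ?_ (hx.1 i)
          calc ∑ j, U i j * Y x k j ≤ ∑ j, Ubar * Y x k j :=
                Finset.sum_le_sum fun j _ =>
                  mul_le_mul_of_nonneg_right (hUle i j) ((hYsimplex x hx k).1 j)
            _ = Ubar := by rw [← Finset.mul_sum, (hYsimplex x hx k).2, mul_one]
      _ = Ubar := by rw [← Finset.sum_mul, hx.2, one_mul]
  have hpm : ∀ k, Measurable fun x => p x k := fun k => by
    have := hYmeas k
    refine Finset.measurable_sum _ fun i _ => (measurable_pi_apply i).mul ?_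
    exact Finset.measurable_sum _ fun j _ => (this j).const_mul _
  clear_value p
  have hadd : ∀ x G G', payoff U Y x (G + G') = payoff U Y x G + payoff U Y x G' := by
    intro x G G'; simp only [hpay, Pi.add_apply, add_mul, Finset.sum_add_distrib]
  have hle : ∀ x ∈ stdSimplex ℝ (Fin N), ∀ G : Fin K → ℝ, (∀ k, 0 ≤ G k) →
      payoff U Y x G ≤ Ubar * ∑ k, G k := by
    intro x hx G hG
    rw [hpay, Finset.mul_sum]
    exact Finset.sum_le_sum fun k _ => by
      rw [mul_comm]; exact mul_le_mul_of_nonneg_right (hp1 x hx k) (hG k)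
  have hge : ∀ x ∈ stdSimplex ℝ (Fin N), ∀ G : Fin K → ℝ, (∀ k, 0 ≤ G k) →
      0 ≤ payoff U Y x G := by
    intro x hx G hG
    rw [hpay]
    exact Finset.sum_nonneg fun k _ => mul_nonneg (hG k) (hp0 x hx k)
  have horac : ∀ x ∈ stdSimplex ℝ (Fin N), ∀ G : Fin K → ℝ, (∀ k, 0 ≤ G k) →
      payoff U Y x G ≤ payoff U Y (W G) G + ε := by
    intro x hx G hG
    have : payoff U Y x G ≤ sSup ((fun x => payoff U Y x G) '' stdSimplex ℝ (Fin N)) :=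
      le_csSup ⟨Ubar * ∑ k, G k, by rintro _ ⟨y, hy, rfl⟩; exact hle y hy G hG⟩ ⟨x, hx, rfl⟩
    linarith [hOracle G hG]
  have hg0 : ∀ t < H, ∀ k, 0 ≤ g t k := by
    intro t ht k
    obtain ⟨i, hi⟩ := hg t ht
    rw [hi]
    by_cases h : k = i
    · subst h; simp
    · simp [h]
  set G : ℕ → Fin K → ℝ := fun t => ∑ τ ∈ Finset.range t, g τ with hGdef
  have hGs : ∀ t, G (t+1) = G t + g t := fun t => Finset.sum_range_succ _ _
  have hG0 : ∀ t ≤ H, ∀ k, 0 ≤ G t k := by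
    intro t ht k
    simp only [hGdef, Finset.sum_apply]
    exact Finset.sum_nonneg fun τ hτ => hg0 τ (by have := Finset.mem_range.1 hτ; omega) k
  have hGσ : ∀ t ≤ H, ∀ σ : Fin K → ℝ, (∀ k, 0 ≤ σ k) → ∀ k, 0 ≤ (G t + σ) k :=
    fun t ht σ hσ k => add_nonneg (hG0 t ht k) (hσ k)
  -- be the leader
  have btl : ∀ σ : Fin K → ℝ, (∀ k, 0 ≤ σ k) → ∀ n ≤ H,
      payoff U Y (W (G n + σ)) (G n + σ) ≤ payoff U Y (W (G 0 + σ)) σ +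
        ∑ t ∈ Finset.range n, payoff U Y (W (G (t+1) + σ)) (g t) + n * ε := by
    intro σ hσ n
    induction n with
    | zero => intro _; simp [hGdef]
    | succ n ih =>
      intro hn
      have ih := ih (by omega)
      have hx := hWsimplex _ (hGσ (n+1) hn σ hσ)
      have h1 := horac _ hx _ (hGσ n (by omega) σ hσ)
      have h2 : payoff U Y (W (G (n+1) + σ)) (G (n+1) + σ) =
          payoff U Y (W (G (n+1) + σ)) (G n + σ) + payoff U Y (W (G (n+1) + σ)) (g n) := by
        rw [← hadd]; congr 1; rw [hGs]; abel
      rw [h2, Finset.sum_range_succ]; push_cast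
      linarith
  have hne : (stdSimplex ℝ (Fin N)).Nonempty := ⟨_, hWsimplex 0 (fun _ => le_rfl)⟩
  have hpt : ∀ σ : Fin K → ℝ, (∀ k, 0 ≤ σ k) →
      sSup ((fun x => payoff U Y x (G H)) '' stdSimplex ℝ (Fin N))
        - ∑ t ∈ Finset.range H, payoff U Y (W (G t + σ)) (g t) ≤
      Ubar * ∑ k, σ k + (∑ t ∈ Finset.range H, (payoff U Y (W (G (t+1) + σ)) (g t)
        - payoff U Y (W (G t + σ)) (g t))) + ε * (H + 1) := by
    intro σ hσ
    have h1 : sSup ((fun x => payoff U Y x (G H)) '' stdSimplex ℝ (Fin N)) ≤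
        payoff U Y (W (G H + σ)) (G H + σ) + ε := by
      refine csSup_le (hne.image _) ?_
      rintro _ ⟨x, hx, rfl⟩
      have := horac x hx _ (hGσ H le_rfl σ hσ)
      rw [hadd x] at this
      linarith [hge x hx σ hσ]
    have h2 := btl σ hσ H le_rfl
    have h3 := hle _ (hWsimplex _ (hGσ 0 (by omega) σ hσ)) σ hσ
    rw [Finset.sum_sub_distrib]
    linarith
  have hprob : IsProbabilityMeasure (uniformCube K ν) := by
    have := cube_prob K hν
    unfold uniformCube; infer_instance
  have hsingle : ∀ x k, payoff U Y x (Pi.single k 1) = p x k := by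
    intro x k; rw [hpay]; simp [Pi.single_apply]
  have hint : ∀ t < H, ∀ s ≤ H,
      Integrable (fun σ => payoff U Y (W (G s + σ)) (g t)) (uniformCube K ν) := by
    intro t ht s hs
    obtain ⟨k, hk⟩ := hg t ht
    simp only [hk, hsingle]
    refine Integrable.of_bound ((hpm k).comp
      (hWmeas.comp (measurable_const_add (G s)))).aestronglyMeasurable Ubar ?_
    filter_upwards [cube_nonneg K ν] with σ hσ
    have hx := hWsimplex _ (hGσ s hs σ hσ)
    rw [Real.norm_eq_abs, abs_of_nonneg (hp0 _ hx k)]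
    exact hp1 _ hx k
  have hdiff : ∀ t < H, ∫ σ, (payoff U Y (W (G (t+1) + σ)) (g t)
        - payoff U Y (W (G t + σ)) (g t)) ∂(uniformCube K ν) ≤ ν * Ubar := by
    intro t ht
    rw [integral_sub (hint t ht (t+1) ht) (hint t ht t ht.le)]
    obtain ⟨k, hk⟩ := hg t ht
    have := cube_shift K hν k (fun σ => p (W (G t + σ)) k)
      ((hpm k).comp (hWmeas.comp (measurable_const_add (G t)))) Ubar hUb0
      (fun σ hσ => hp0 _ (hWsimplex _ (hGσ t ht.le σ hσ)) k)
      (fun σ hσ => hp1 _ (hWsimplex _ (hGσ t ht.le σ hσ)) k)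
    have e : ∀ σ, G (t+1) + σ = G t + (σ + Pi.single k 1) := by
      intro σ; rw [hGs, hk]; abel
    simp only [e, hk, hsingle]
    nlinarith [mul_nonneg hUb0 hν.le]
  have hs1 : Integrable (fun σ : Fin K → ℝ => Ubar * ∑ k, σ k) (uniformCube K ν) :=
    (integrable_finsetSum _ fun k _ => (cube_mean K hν k).1).const_mul _
  have hs2 : Integrable (fun σ : Fin K → ℝ => ∑ t ∈ Finset.range H,
      (payoff U Y (W (G (t+1) + σ)) (g t) - payoff U Y (W (G t + σ)) (g t))) (uniformCube K ν) :=
    integrable_finsetSum _ fun t ht =>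
      (hint t (Finset.mem_range.1 ht) (t+1) (Finset.mem_range.1 ht)).sub
        (hint t (Finset.mem_range.1 ht) t (Finset.mem_range.1 ht).le)
  have hsum : ∫ σ, ∑ t ∈ Finset.range H, (payoff U Y (W (G (t+1) + σ)) (g t)
        - payoff U Y (W (G t + σ)) (g t)) ∂(uniformCube K ν) = ∑ t ∈ Finset.range H,
      ∫ σ, (payoff U Y (W (G (t+1) + σ)) (g t)
        - payoff U Y (W (G t + σ)) (g t)) ∂(uniformCube K ν) :=
    integral_finsetSum _ fun t ht => (hint t (Finset.mem_range.1 ht) (t+1)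
        (Finset.mem_range.1 ht)).sub (hint t (Finset.mem_range.1 ht) t (Finset.mem_range.1 ht).le)
  refine (integral_mono_ae ?_ ((hs1.add hs2).add (integrable_const (ε * (H + 1)))) ?_).trans ?_
  · exact (integrable_const _).sub (integrable_finsetSum _ fun t ht =>
      hint t (Finset.mem_range.1 ht) t (Finset.mem_range.1 ht).le)
  · filter_upwards [cube_nonneg K ν] with σ hσ using hpt σ hσ
  · rw [integral_add' (hs1.add hs2) (integrable_const _), integral_add' hs1 hs2,
      integral_const_mul, integral_finsetSum _ fun k _ => (cube_mean K hν k).1,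
      hsum]
    simp only [fun k => (cube_mean K hν k).2]
    have := Finset.sum_le_sum fun t ht => hdiff t (Finset.mem_range.1 ht)
    simp only [Finset.sum_const, Finset.card_range, nsmul_eq_mul, Finset.card_univ,
      Fintype.card_fin] at this ⊢
    rw [integral_const]
    simp only [probReal_univ, one_smul]
    have e : Ubar * (K * (1 / ν)) = Ubar * K / ν := by ring
    rw [e]
    linarith
end

section
/- Let N, M, K, H be positive integers, let U ∈ ℝ^{N×M} have nonnegative entries with Ū = max_{i,j} U_{ij}, and let ε ≥ 0. Let 𝒴 : Δ_N → ℝ^{M×K} be a measurable map each of whose columns lies in Δ_M. Let g^1, …, g^H ∈ {e_1,…,e_K} (standard basis of ℝ^K) and set G^t = Σ_{τ=1}^t g^τ with G^0 = 0. Set ν = √(K/H) and let σ = (σ_1,…,σ_K) have i.i.d. coordinates uniform on [0, 2/ν]. Suppose W : ℝ^K_{≥0} → Δ_N is a measurable map satisfying ⟨𝒴(W(G))ᵀ Uᵀ W(G), G⟩ ≥ sup_{x∈Δ_N} ⟨𝒴(x)ᵀ Uᵀ x, G⟩ − ε for every G ∈ ℝ^K_{≥0}, and set x^t = W(G^{t−1}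 + σ) for t = 1, …, H. Then E[ sup_{x∈Δ_N} ⟨𝒴(x)ᵀ Uᵀ x, G^H⟩ − Σ_{t=1}^H ⟨𝒴(x^t)ᵀ Uᵀ x^t, g^t⟩ ] ≤ 2 Ū √(K H) + ε(H+1), where the expectation is over σ. -/
open MeasureTheory

lemma q_bounds {N M K : ℕ} (U : Matrix (Fin N) (Fin M) ℝ) (hU : ∀ i j, 0 ≤ U i j)
    (B : ℝ) (hB : ∀ i j, U i j ≤ B)
    (Y : (Fin N → ℝ) → Fin K → Fin M → ℝ)
    (hY : ∀ x ∈ stdSimplex ℝ (Fin N), ∀ k, Y x k ∈ stdSimplex ℝ (Fin M))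
    (x : Fin N → ℝ) (hx : x ∈ stdSimplex ℝ (Fin N)) (k : Fin K) :
    0 ≤ ∑ i, x i * ∑ j, U i j * Y x k j ∧ ∑ i, x i * ∑ j, U i j * Y x k j ≤ B := by
  obtain ⟨hy0, hy1⟩ := hY x hx k
  obtain ⟨hx0, hx1⟩ := hx
  constructor
  · exact Finset.sum_nonneg fun i _ => mul_nonneg (hx0 i)
      (Finset.sum_nonneg fun j _ => mul_nonneg (hU i j) (hy0 j))
  · calc ∑ i, x i * ∑ j, U i j * Y x k j ≤ ∑ i, x i * ∑ j, B * Y x k j := by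
          apply Finset.sum_le_sum
          intro i _
          apply mul_le_mul_of_nonneg_left _ (hx0 i)
          exact Finset.sum_le_sum fun j _ => mul_le_mul_of_nonneg_right (hB i j) (hy0 j)
      _ = B := by
          rw [← Finset.mul_sum, hy1, ← Finset.sum_mul, hx1]; ring

lemma payoff_add {N M K : ℕ} (U : Matrix (Fin N) (Fin M) ℝ)
    (Y : (Fin N → ℝ) → Fin K → Fin M → ℝ) (x : Fin N → ℝ) (g h : Fin K → ℝ) :
    payoff U Y x (g + h) = payoff U Y x g + payoff U Y x h := by
  simp [payoff, add_mul, Finset.sum_add_distrib]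

lemma payoff_single {N M K : ℕ} (U : Matrix (Fin N) (Fin M) ℝ)
    (Y : (Fin N → ℝ) → Fin K → Fin M → ℝ) (x : Fin N → ℝ) (k : Fin K) :
    payoff U Y x (Pi.single k 1) = ∑ i, x i * ∑ j, U i j * Y x k j := by
  simp [payoff, Pi.single_apply]

lemma uniformCube_eq (K : ℕ) (ν : ℝ) (hν : 0 < ν) :
    uniformCube K ν = ((ENNReal.ofReal (2 / ν))⁻¹ ^ K) •
      (volume.restrict (Set.Icc (0 : Fin K → ℝ) (fun _ => 2 / ν))) := by
  have hL : 0 < 2 / ν := by positivity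
  have hc : (ENNReal.ofReal (2 / ν))⁻¹ ≠ ⊤ := by simp [hL]
  have : IsFiniteMeasure ((ENNReal.ofReal (2 / ν))⁻¹ •
    (volume.restrict (Set.Icc (0 : ℝ) (2 / ν)))) := Measure.smul_finite _ hc
  unfold uniformCube
  apply Measure.pi_eq
  intro s hs
  rw [Measure.smul_apply, Measure.restrict_apply (MeasurableSet.univ_pi hs)]
  have : (Set.univ.pi s ∩ Set.Icc (0 : Fin K → ℝ) (fun _ => 2 / ν)) =
      Set.univ.pi (fun i => s i ∩ Set.Icc (0 : ℝ) (2 / ν)) := by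
    rw [← Set.pi_univ_Icc, ← Set.pi_inter_distrib]; rfl
  rw [this, volume_pi_pi]
  simp [Measure.restrict_apply, hs, Finset.prod_mul_distrib]

lemma uniformCube_prob (K : ℕ) (ν : ℝ) (hν : 0 < ν) :
    IsProbabilityMeasure ((ENNReal.ofReal (2 / ν))⁻¹ •
      (volume.restrict (Set.Icc (0 : ℝ) (2 / ν)))) := by
  have hL : 0 < 2 / ν := by positivity
  constructor
  simp only [Measure.smul_apply, smul_eq_mul, MeasurableSet.univ, Measure.restrict_apply,
    Set.univ_inter, Real.volume_Icc, sub_zero]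
  exact ENNReal.inv_mul_cancel (by simp [hL]) (by simp)

lemma uniformCube_ae_nonneg (K : ℕ) (ν : ℝ) (hν : 0 < ν) :
    ∀ᵐ σ ∂(uniformCube K ν), ∀ k, 0 ≤ σ k := by
  rw [uniformCube_eq K ν hν]
  apply Measure.ae_smul_measure
  filter_upwards [ae_restrict_mem measurableSet_Icc] with σ hσ k using hσ.1 k

lemma uniformCube_mean (K : ℕ) (ν : ℝ) (hν : 0 < ν) (k : Fin K) :
    Integrable (fun σ : Fin K → ℝ => σ k) (uniformCube K ν) ∧
    ∫ σ, σ k ∂(uniformCube K ν) = 1 / ν := by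
  have hL : 0 < 2 / ν := by positivity
  have hp := uniformCube_prob K ν hν
  have hc : (ENNReal.ofReal (2 / ν))⁻¹ ≠ ⊤ := by simp [hL]
  have hi : Integrable (fun s : ℝ => s) ((ENNReal.ofReal (2 / ν))⁻¹ •
      (volume.restrict (Set.Icc (0 : ℝ) (2 / ν)))) := by
    apply Integrable.smul_measure _ hc
    exact (continuous_id.integrableOn_Icc)
  have hmp := measurePreserving_eval (fun _ : Fin K => (ENNReal.ofReal (2 / ν))⁻¹ •
      (volume.restrict (Set.Icc (0 : ℝ) (2 / ν)))) k
  constructor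
  · exact hmp.integrable_comp_of_integrable hi
  · have h1 := integral_map (μ := uniformCube K ν) (φ := fun σ : Fin K → ℝ => σ k)
      (measurable_pi_apply k).aemeasurable (f := fun s : ℝ => s)
      (measurable_id.aestronglyMeasurable)
    rw [← h1]
    have h2 := hmp.map_eq
    change Measure.map (fun σ : Fin K → ℝ => σ k) (uniformCube K ν) = _ at h2
    rw [h2, integral_smul_measure, integral_Icc_eq_integral_Ioc,
      ← intervalIntegral.integral_of_le hL.le, integral_id, ENNReal.toReal_inv,
      ENNReal.toReal_ofReal hL.le, smul_eq_mul]
    field_simp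
    norm_num

lemma uniformCube_shift (K : ℕ) (ν : ℝ) (hν : 0 < ν) (k : Fin K) (B : ℝ)
    (f : (Fin K → ℝ) → ℝ) (hf : Measurable f) (h0 : ∀ σ, 0 ≤ f σ) (hB : ∀ σ, f σ ≤ B) :
    ∫ σ, f (σ + Pi.single k 1) ∂(uniformCube K ν) ≤
      ∫ σ, f σ ∂(uniformCube K ν) + B * (ν / 2) := by
  have hL : 0 < 2 / ν := by positivity
  set L := 2 / ν with hLdef
  set c : ENNReal := (ENNReal.ofReal L)⁻¹ ^ K with hc
  have hct : c ≠ ⊤ := by simp [hc, hL]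
  set C := Set.Icc (0 : Fin K → ℝ) (fun _ => L) with hC
  set C' := Set.Icc (Pi.single k L : Fin K → ℝ) ((fun _ => L) + Pi.single k 1) with hC'
  have hμ : uniformCube K ν = c • volume.restrict C := uniformCube_eq K ν hν
  have hvolC' : volume C' = ENNReal.ofReal (L ^ (K - 1)) := by
    rw [hC', Real.volume_Icc_pi, ← Finset.mul_prod_erase _ _ (Finset.mem_univ k)]
    rw [Finset.prod_congr rfl (g := fun _ => ENNReal.ofReal L)]
    · simp [Finset.card_erase_of_mem, ENNReal.ofReal_pow hL.le]
    · intro i hi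
      have : i ≠ k := Finset.ne_of_mem_erase hi
      simp [this]
  have : IsFiniteMeasure (volume.restrict C) := by
    constructor; rw [Measure.restrict_apply_univ]; exact isCompact_Icc.measure_lt_top
  have : IsFiniteMeasure (volume.restrict C') := by
    constructor; rw [Measure.restrict_apply_univ]; exact isCompact_Icc.measure_lt_top
  have : IsFiniteMeasure (c • volume.restrict C) := Measure.smul_finite _ hct
  have : IsFiniteMeasure (c • volume.restrict C') := Measure.smul_finite _ hct
  have hmap : Measure.map (fun σ => σ + (Pi.single k 1 : Fin K → ℝ)) (uniformCube K ν) ≤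
      c • volume.restrict C + c • volume.restrict C' := by
    rw [hμ, Measure.map_smul, ← smul_add]
    have hmp : MeasurePreserving (fun σ : Fin K → ℝ => σ + Pi.single k 1) volume volume :=
      measurePreserving_add_right volume _
    have hsub : Set.Icc (Pi.single k 1 : Fin K → ℝ) ((fun _ => L) + Pi.single k 1) ⊆ C ∪ C' := by
      intro σ hσ
      have hpos : ∀ i, 0 ≤ σ i := fun i =>
        le_trans (by by_cases h : i = k <;> simp [Pi.single_apply, h]) (hσ.1 i)
      by_cases h : σ k ≤ L
      · left
        refine ⟨hpos, fun i => ?_⟩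
        by_cases hi : i = k
        · subst hi; exact h
        · simpa [hi] using hσ.2 i
      · right
        refine ⟨fun i => ?_, hσ.2⟩
        by_cases hi : i = k
        · subst hi; simpa using (not_le.mp h).le
        · simpa [hi] using hpos i
    have hpre : (fun σ : Fin K → ℝ => σ + Pi.single k 1) ⁻¹'
        (Set.Icc (Pi.single k 1 : Fin K → ℝ) ((fun _ => L) + Pi.single k 1)) = C := by
      rw [Set.preimage_add_const_Icc]; simp [hC]
    have h1 := (hmp.restrict_preimage (s := Set.Icc (Pi.single k 1 : Fin K → ℝ)
      ((fun _ => L) + Pi.single k 1)) measurableSet_Icc).map_eq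
    rw [hpre] at h1
    rw [h1]
    have hle := (Measure.restrict_mono hsub (le_refl volume)).trans
      (Measure.restrict_union_le _ _)
    refine Measure.le_iff.mpr fun s _ => ?_
    rw [Measure.smul_apply, Measure.smul_apply, smul_eq_mul, smul_eq_mul]
    exact mul_le_mul_right (hle s) c
  have hfInt : ∀ (m : Measure (Fin K → ℝ)) [IsFiniteMeasure m], Integrable f m := by
    intro m _
    refine Integrable.of_bound hf.aestronglyMeasurable B ?_
    exact Filter.Eventually.of_forall fun σ => by
      rw [Real.norm_eq_abs, abs_of_nonneg (h0 σ)]; exact hB σ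
  have hB0 : 0 ≤ B := (h0 0).trans (hB 0)
  have hch := integral_map (μ := uniformCube K ν)
    (φ := fun σ : Fin K → ℝ => σ + Pi.single k 1) (f := f)
    (measurable_add_const _).aemeasurable hf.aestronglyMeasurable
  rw [← hch]
  refine (integral_mono_measure hmap (Filter.Eventually.of_forall h0) (hfInt _)).trans ?_
  rw [integral_add_measure (hfInt _) (hfInt _), ← hμ]
  gcongr
  calc ∫ σ, f σ ∂(c • volume.restrict C') ≤ ∫ σ, B ∂(c • volume.restrict C') :=
        integral_mono (hfInt _) (integrable_const _) hB
    _ = B * (ν / 2) := by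
        have hK : K ≠ 0 := by rintro rfl; exact k.elim0
        rw [integral_const, smul_eq_mul, mul_comm, measureReal_def, Measure.smul_apply,
          Measure.restrict_apply_univ, hvolC', smul_eq_mul, ENNReal.toReal_mul, hc,
          ENNReal.toReal_pow, ENNReal.toReal_inv, ENNReal.toReal_ofReal hL.le,
          ENNReal.toReal_ofReal (by positivity)]
        congr 1
        obtain ⟨n, rfl⟩ := Nat.exists_eq_succ_of_ne_zero hK
        have : ν / 2 = L⁻¹ := by simp [hLdef]
        rw [this]
        simp only [Nat.succ_eq_add_one, Nat.add_sub_cancel, pow_succ]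
        rw [inv_pow]
        field_simp

/-- **Theorem 2: O(√(KH)) regret of FTPL against memory-less followers.**
Here the perturbation rate is tuned to `ν = √(K/H)`.
Leader payoff matrix `U ≥ 0` with maximal entry `Ū`; follower response map `𝒴 : Δ_N → ℝ^{M×K}`
measurable with columns in `Δ_M`; follower types `g^1, …, g^H ∈ {e_1,…,e_K}` with partial sums
`G^t`; `σ` uniform on `[0, 2/ν]^K`; `W` an `ε`-approximate maximization oracle of
`x ↦ ⟨𝒴(x)ᵀ Uᵀ x, G⟩` over `Δ_N` for every `G ≥ 0`; decisions `x^t = W(G^{t−1} + σ)`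
(0-indexed: round `t < H` uses `G t = ∑_{τ<t} g τ`).  Then the expected regret satisfies
`E[sup_{x∈Δ_N} ⟨𝒴(x)ᵀUᵀx, G^H⟩ − ∑_t ⟨𝒴(x^t)ᵀUᵀx^t, g^t⟩] ≤ 2Ū√(KH) + ε(H+1)`. -/
theorem stmt8 {N M K : ℕ} (hN : 0 < N) (hM : 0 < M) (hK : 0 < K)
    (H : ℕ) (hH : 0 < H)
    (U : Matrix (Fin N) (Fin M) ℝ) (hU : ∀ i j, 0 ≤ U i j)
    (Ubar : ℝ)
    (hUbar : Ubar = Finset.univ.sup' (Finset.univ_nonempty_iff.mpr ⟨⟨0, hN⟩⟩)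
      (fun i => Finset.univ.sup' (Finset.univ_nonempty_iff.mpr ⟨⟨0, hM⟩⟩) (fun j => U i j)))
    (ε ν : ℝ) (hε : 0 ≤ ε) (hν : ν = Real.sqrt (K / H))
    (Y : (Fin N → ℝ) → Fin K → Fin M → ℝ)
    (hYmeas : ∀ k j, Measurable (fun x => Y x k j))
    (hYsimplex : ∀ x ∈ stdSimplex ℝ (Fin N), ∀ k, Y x k ∈ stdSimplex ℝ (Fin M))
    (g : ℕ → Fin K → ℝ) (hg : ∀ t < H, ∃ k, g t = Pi.single k 1)
    (W : (Fin K → ℝ) → (Fin N → ℝ)) (hWmeas : Measurable W)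
    (hWsimplex : ∀ G : Fin K → ℝ, (∀ k, 0 ≤ G k) → W G ∈ stdSimplex ℝ (Fin N))
    (hOracle : ∀ G : Fin K → ℝ, (∀ k, 0 ≤ G k) →
      sSup ((fun x => payoff U Y x G) '' stdSimplex ℝ (Fin N)) - ε ≤ payoff U Y (W G) G) :
    (∫ σ, (sSup ((fun x => payoff U Y x (∑ τ ∈ Finset.range H, g τ)) '' stdSimplex ℝ (Fin N))
        - ∑ t ∈ Finset.range H, payoff U Y (W ((∑ τ ∈ Finset.range t, g τ) + σ)) (g t))
      ∂(uniformCube K ν)) ≤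
      2 * Ubar * Real.sqrt (K * H) + ε * (H + 1) := by
  have hKR : (0 : ℝ) < K := by exact_mod_cast hK
  have hHR : (0 : ℝ) < H := by exact_mod_cast hH
  have hνpos : 0 < ν := by rw [hν]; positivity
  have hB : ∀ i j, U i j ≤ Ubar := by
    intro i j
    rw [hUbar]
    exact (Finset.le_sup' (fun j => U i j) (Finset.mem_univ j)).trans
      (Finset.le_sup' (fun i => Finset.univ.sup' (Finset.univ_nonempty_iff.mpr ⟨⟨0, hM⟩⟩)
        (fun j => U i j)) (Finset.mem_univ i))
  have hB0 : 0 ≤ Ubar := (hU ⟨0, hN⟩ ⟨0, hM⟩).trans (hB _ _)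
  have hq := q_bounds U hU Ubar hB Y hYsimplex
  have hpay_le : ∀ x ∈ stdSimplex ℝ (Fin N), ∀ G : Fin K → ℝ, (∀ k, 0 ≤ G k) →
      payoff U Y x G ≤ Ubar * ∑ k, G k := by
    intro x hx G hG
    unfold payoff
    rw [Finset.mul_sum]
    refine Finset.sum_le_sum fun k _ => ?_
    rw [mul_comm Ubar]
    exact mul_le_mul_of_nonneg_left (hq x hx k).2 (hG k)
  have hpay_nonneg : ∀ x ∈ stdSimplex ℝ (Fin N), ∀ G : Fin K → ℝ, (∀ k, 0 ≤ G k) →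
      0 ≤ payoff U Y x G := fun x hx G hG =>
    Finset.sum_nonneg fun k _ => mul_nonneg (hG k) (hq x hx k).1
  have hne : (stdSimplex ℝ (Fin N)).Nonempty :=
    ⟨W 0, hWsimplex 0 (fun _ => le_rfl)⟩
  obtain ⟨V, hV⟩ : ∃ V : (Fin K → ℝ) → ℝ, V = fun G =>
    sSup ((fun x => payoff U Y x G) '' stdSimplex ℝ (Fin N)) := ⟨_, rfl⟩
  have hVle : ∀ G : Fin K → ℝ, (∀ k, 0 ≤ G k) → ∀ x ∈ stdSimplex ℝ (Fin N),
      payoff U Y x G ≤ V G := by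
    intro G hG x hx
    rw [hV]
    refine le_csSup ⟨Ubar * ∑ k, G k, ?_⟩ ⟨x, hx, rfl⟩
    rintro _ ⟨y, hy, rfl⟩
    exact hpay_le y hy G hG
  have hVub : ∀ (G : Fin K → ℝ) (b : ℝ),
      (∀ x ∈ stdSimplex ℝ (Fin N), payoff U Y x G ≤ b) → V G ≤ b := by
    intro G b h
    rw [hV]
    refine csSup_le (hne.image _) ?_
    rintro _ ⟨y, hy, rfl⟩
    exact h y hy
  have hOr : ∀ G : Fin K → ℝ, (∀ k, 0 ≤ G k) → V G - ε ≤ payoff U Y (W G) G := by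
    rw [hV]; exact hOracle
  have hg0 : ∀ t < H, ∀ k, 0 ≤ g t k := by
    intro t ht k
    obtain ⟨k', h⟩ := hg t ht
    rw [h]
    by_cases hk : k = k' <;> simp [Pi.single_apply, hk]
  have hG0 : ∀ t ≤ H, ∀ k, 0 ≤ (∑ τ ∈ Finset.range t, g τ) k := by
    intro t ht k
    rw [Finset.sum_apply]
    exact Finset.sum_nonneg fun τ hτ => hg0 τ ((Finset.mem_range.mp hτ).trans_le ht) k
  -- the clipped per-round payoffs
  let F : ℕ → (Fin K → ℝ) → ℝ := fun t σ =>
    max 0 (min Ubar (payoff U Y (W ((∑ τ ∈ Finset.range t, g τ) + σ)) (g t)))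
  have hF0 : ∀ t σ, 0 ≤ F t σ := fun t σ => le_max_left _ _
  have hFB : ∀ t σ, F t σ ≤ Ubar := fun t σ => max_le hB0 (min_le_left _ _)
  have hFm : ∀ t, Measurable (F t) := by
    intro t
    have hWm : Measurable (fun σ : Fin K → ℝ => W ((∑ τ ∈ Finset.range t, g τ) + σ)) :=
      hWmeas.comp (measurable_const_add _)
    have hpm : Measurable (fun x => payoff U Y x (g t)) := by
      unfold payoff
      refine Finset.measurable_sum _ fun k _ => Measurable.const_mul ?_ _
      refine Finset.measurable_sum _ fun i _ => (measurable_pi_apply i).mul ?_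
      exact Finset.measurable_sum _ fun j _ => (hYmeas k j).const_mul _
    exact measurable_const.max (measurable_const.min (hpm.comp hWm))
  have hFeq : ∀ t < H, ∀ σ : Fin K → ℝ, (∀ k, 0 ≤ σ k) →
      F t σ = payoff U Y (W ((∑ τ ∈ Finset.range t, g τ) + σ)) (g t) := by
    intro t ht σ hσ
    have hs : W ((∑ τ ∈ Finset.range t, g τ) + σ) ∈ stdSimplex ℝ (Fin N) :=
      hWsimplex _ fun k => add_nonneg (hG0 t ht.le k) (hσ k)
    obtain ⟨k, hk⟩ := hg t ht
    have hb := hq _ hs k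
    rw [← payoff_single, ← hk] at hb
    simp only [F]
    rw [min_eq_right hb.2, max_eq_right hb.1]
  have hbtl : ∀ σ : Fin K → ℝ, (∀ k, 0 ≤ σ k) → ∀ n ≤ H,
      V ((∑ τ ∈ Finset.range n, g τ) + σ) ≤
        V σ + (∑ t ∈ Finset.range n, F t (σ + g t)) + n * ε := by
    intro σ hσ n
    induction n with
    | zero => intro _; simp
    | succ n ih =>
      intro hn
      have hn' : n < H := hn
      have hpos : ∀ k, 0 ≤ ((∑ τ ∈ Finset.range (n + 1), g τ) + σ) k :=
        fun k => add_nonneg (hG0 _ hn k) (hσ k)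
      have h1 := hOr _ hpos
      have hs := hWsimplex _ hpos
      have hspl : (∑ τ ∈ Finset.range (n + 1), g τ) + σ =
          ((∑ τ ∈ Finset.range n, g τ) + σ) + g n := by
        rw [Finset.sum_range_succ]; abel
      have hspl2 : (∑ τ ∈ Finset.range (n + 1), g τ) + σ =
          (∑ τ ∈ Finset.range n, g τ) + (σ + g n) := by
        rw [Finset.sum_range_succ]; abel
      have h2 : payoff U Y (W ((∑ τ ∈ Finset.range (n + 1), g τ) + σ))
          ((∑ τ ∈ Finset.range (n + 1), g τ) + σ) =
          payoff U Y (W ((∑ τ ∈ Finset.range (n + 1), g τ) + σ))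
            ((∑ τ ∈ Finset.range n, g τ) + σ) +
          payoff U Y (W ((∑ τ ∈ Finset.range (n + 1), g τ) + σ)) (g n) := by
        rw [← payoff_add, ← hspl]
      have h3 := hVle ((∑ τ ∈ Finset.range n, g τ) + σ)
        (fun k => add_nonneg (hG0 _ hn'.le k) (hσ k)) _ hs
      have h4 := hFeq n hn' (σ + g n) (fun k => add_nonneg (hσ k) (hg0 n hn' k))
      rw [← hspl2] at h4
      have h5 := ih hn'.le
      rw [Finset.sum_range_succ (fun t => F t (σ + g t)), h4]
      push_cast
      linarith
  have hpt : ∀ σ : Fin K → ℝ, (∀ k, 0 ≤ σ k) →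
      V (∑ τ ∈ Finset.range H, g τ) - ∑ t ∈ Finset.range H, F t σ ≤
        Ubar * ∑ k, σ k + H * ε + ∑ t ∈ Finset.range H, (F t (σ + g t) - F t σ) := by
    intro σ hσ
    have h1 := hbtl σ hσ H le_rfl
    have h2 : V σ ≤ Ubar * ∑ k, σ k := hVub _ _ fun x hx => hpay_le x hx σ hσ
    have h3 : V (∑ τ ∈ Finset.range H, g τ) ≤ V ((∑ τ ∈ Finset.range H, g τ) + σ) := by
      refine hVub _ _ fun x hx => ?_
      refine le_trans ?_ (hVle ((∑ τ ∈ Finset.range H, g τ) + σ)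
        (fun k => add_nonneg (hG0 H le_rfl k) (hσ k)) x hx)
      rw [payoff_add]
      linarith [hpay_nonneg x hx σ hσ]
    rw [Finset.sum_sub_distrib]
    linarith
  have hae := uniformCube_ae_nonneg K ν hνpos
  have hprob : IsProbabilityMeasure (uniformCube K ν) := by
    have := uniformCube_prob K ν hνpos
    unfold uniformCube
    infer_instance
  have hFi : ∀ t, Integrable (F t) (uniformCube K ν) := fun t =>
    Integrable.of_bound (hFm t).aestronglyMeasurable Ubar (Filter.Eventually.of_forall fun σ => by
      rw [Real.norm_eq_abs, abs_of_nonneg (hF0 t σ)]; exact hFB t σ)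
  have hFsi : ∀ t, Integrable (fun σ => F t (σ + g t)) (uniformCube K ν) := fun t =>
    Integrable.of_bound ((hFm t).comp (measurable_add_const (g t))).aestronglyMeasurable Ubar
      (Filter.Eventually.of_forall fun σ => by
        rw [Real.norm_eq_abs, abs_of_nonneg (hF0 t _)]; exact hFB t _)
  have hσi : Integrable (fun σ : Fin K → ℝ => Ubar * ∑ k, σ k) (uniformCube K ν) :=
    (integrable_finsetSum _ fun k _ => (uniformCube_mean K ν hνpos k).1).const_mul _
  have hσi2 : Integrable (fun σ : Fin K → ℝ => Ubar * ∑ k, σ k + H * ε) (uniformCube K ν) :=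
    hσi.add (integrable_const _)
  have hdi : ∀ t, Integrable (fun σ : Fin K → ℝ => F t (σ + g t) - F t σ) (uniformCube K ν) :=
    fun t => (hFsi t).sub (hFi t)
  have hsumi : Integrable (fun σ : Fin K → ℝ => ∑ t ∈ Finset.range H, (F t (σ + g t) - F t σ))
      (uniformCube K ν) := integrable_finsetSum _ fun t _ => (hFsi t).sub (hFi t)
  have hlhs : (∫ σ, (sSup ((fun x => payoff U Y x (∑ τ ∈ Finset.range H, g τ)) ''
        stdSimplex ℝ (Fin N))
        - ∑ t ∈ Finset.range H, payoff U Y (W ((∑ τ ∈ Finset.range t, g τ) + σ)) (g t))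
      ∂(uniformCube K ν)) =
      ∫ σ, (V (∑ τ ∈ Finset.range H, g τ) - ∑ t ∈ Finset.range H, F t σ) ∂(uniformCube K ν) := by
    refine integral_congr_ae ?_
    filter_upwards [hae] with σ hσ
    rw [hV]
    congr 1
    exact Finset.sum_congr rfl fun t ht => (hFeq t (Finset.mem_range.mp ht) σ hσ).symm
  rw [hlhs]
  have hmono : ∫ σ, (V (∑ τ ∈ Finset.range H, g τ) - ∑ t ∈ Finset.range H, F t σ)
      ∂(uniformCube K ν) ≤ ∫ σ, (Ubar * ∑ k, σ k + H * ε +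
        ∑ t ∈ Finset.range H, (F t (σ + g t) - F t σ)) ∂(uniformCube K ν) := by
    refine integral_mono_ae ?_ ?_ ?_
    · exact (integrable_const _).sub (integrable_finsetSum _ fun t _ => hFi t)
    · exact (hσi.add (integrable_const _)).add hsumi
    · filter_upwards [hae] with σ hσ using hpt σ hσ
  refine hmono.trans ?_
  rw [integral_add hσi2 hsumi, integral_add hσi (integrable_const _),
    integral_const_mul, integral_finsetSum _ fun k _ => (uniformCube_mean K ν hνpos k).1,
    integral_finsetSum _ fun t _ => hdi t]
  simp only [(uniformCube_mean K ν hνpos _).2, integral_const, probReal_univ, one_smul,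
    Finset.sum_const, Finset.card_univ, Fintype.card_fin, nsmul_eq_mul]
  have hstab : ∑ t ∈ Finset.range H, ∫ σ, (F t (σ + g t) - F t σ) ∂(uniformCube K ν) ≤
      H * (Ubar * (ν / 2)) := by
    have : ∀ t ∈ Finset.range H, ∫ σ, (F t (σ + g t) - F t σ) ∂(uniformCube K ν) ≤
        Ubar * (ν / 2) := by
      intro t ht
      obtain ⟨k, hk⟩ := hg t (Finset.mem_range.mp ht)
      rw [integral_sub (hFsi t) (hFi t), hk]
      linarith [uniformCube_shift K ν hνpos k Ubar (F t) (hFm t) (hF0 t) (hFB t)]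
    simpa using Finset.sum_le_card_nsmul _ _ _ this
  have hs0 : 0 ≤ Real.sqrt (K * H) := Real.sqrt_nonneg _
  have hHν : H * ν = Real.sqrt (K * H) := by
    rw [hν, Real.sqrt_div hKR.le, Real.sqrt_mul hKR.le]
    have := Real.mul_self_sqrt hHR.le
    field_simp
    nlinarith
  have hKν : (K : ℝ) * (1 / ν) = Real.sqrt (K * H) := by
    rw [hν, Real.sqrt_div hKR.le, Real.sqrt_mul hKR.le]
    have := Real.mul_self_sqrt hKR.le
    field_simp
    nlinarith
  rw [hKν]
  have : H * (Ubar * (ν / 2)) = Ubar * Real.sqrt (K * H) / 2 := by rw [← hHν]; ring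
  nlinarith [mul_nonneg hB0 hs0]
end
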